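/- Let 1 ≤ p < ∞, let Y be a compact metric space, and let Γ be a group with finite generating set S acting freely on Y by homeomorphisms. Assume the action is linearizable in ℓ^p and that Γ, with the word metric of S, admits a coarse embedding into ℓ^p, i.e. there are non-decreasing functions ρ₋, ρ₊ : [0,∞) → [0,∞) with ρ₋(t) → ∞ as t → ∞ and a map g : Γ → ℓ^p with ρ₋(d(γ,η)) ≤ ‖g(γ) − g(η)‖_p ≤ ρ₊(d(γ,η)) for all γ, η ∈ Γ. Then the warped cone O_Γ Y admits a coarse embedding at infinity into ℓ^p. -/

import Mathlib

open Metric Bornology Filter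
open scoped ENNReal

/-- The metric on a group `G` is the word metric of the finite generating set `S`. -/
def IsWordMetric (G : Type*) [Group G] [MetricSpace G] (S : Finset G) : Prop :=
  Subgroup.closure (S : Set G) = ⊤ ∧
  ∀ g h : G, dist g h =
    sInf {r : ℝ | ∃ l : List G, (∀ x ∈ l, x ∈ S ∨ x⁻¹ ∈ S) ∧ l.prod = g⁻¹ * h ∧
      r = (l.length : ℝ)}

/-- The underlying set of the (intrinsic open cone over and) warped cone over `Y`:
`Y × (0, ∞)`. -/
def WarpedCone (Y : Type*) : Type _ := Y × {t : ℝ // (0:ℝ) < t}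

/-- The base point of a point of the cone. -/
def WarpedCone.base {Y : Type*} (x : WarpedCone Y) : Y := x.1

/-- The height of a point of the cone. -/
def WarpedCone.height {Y : Type*} (x : WarpedCone Y) : ℝ := x.2.1

/-- The action of `Γ` on the cone induced by an action on `Y` (trivial on heights). -/
def WarpedCone.act {Γ Y : Type*} [Group Γ] [MulAction Γ Y] (γ : Γ) (x : WarpedCone Y) :
    WarpedCone Y := (γ • x.1, x.2)

/-- The metric of the intrinsic open cone `OY` over a compact metric space `Y`:
`d((y₁,t₁),(y₂,t₂)) = |t₁ − t₂| + min(t₁,t₂)·d(y₁,y₂)/diam Y`. -/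
noncomputable def coneDist {Y : Type*} [MetricSpace Y] (a b : WarpedCone Y) : ℝ :=
  |a.height - b.height| + min a.height b.height * dist a.base b.base /
    diam (Set.univ : Set Y)

/-- `X` admits a coarse embedding at infinity into the fixed normed space `E`. -/
def CoarseEmbAtInfinityInto (X : Type*) [MetricSpace X]
    (E : Type*) [NormedAddCommGroup E] : Prop :=
  ∃ ρm ρp : ℝ → ℝ,
    Monotone ρm ∧ Monotone ρp ∧
    Tendsto ρm atTop atTop ∧ Tendsto ρp atTop atTop ∧
    ∀ R : ℝ, 0 < R → ∃ K : Set X, IsBounded K ∧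
      ∀ C : Set X, IsBounded C → C ⊆ Kᶜ → diam C ≤ R →
        ∃ f : C → E,
          ∀ x y : C, ρm (dist (x : X) (y : X)) ≤ ‖f x - f y‖ ∧
            ‖f x - f y‖ ≤ ρp (dist (x : X) (y : X))

namespace IsWordMetric

variable {G : Type*} [Group G] [MetricSpace G] {S : Finset G}

theorem exists_list (h : IsWordMetric G S) (a b : G) :
    ∃ l : List G, (∀ x ∈ l, x ∈ S ∨ x⁻¹ ∈ S) ∧ l.prod = a⁻¹ * b ∧
      dist a b = (l.length : ℝ) := by
  classical
  have hmem : a⁻¹ * b ∈ (Subgroup.closure (S : Set G)).toSubmonoid := by rw [h.1]; trivial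
  rw [Subgroup.closure_toSubmonoid] at hmem
  obtain ⟨l₀, hl₀, hp₀⟩ := Submonoid.exists_list_of_mem_closure hmem
  have hex : ∃ n : ℕ, ∃ l : List G, (∀ x ∈ l, x ∈ S ∨ x⁻¹ ∈ S) ∧ l.prod = a⁻¹ * b ∧
      l.length = n := ⟨_, l₀, by simpa using hl₀, hp₀, rfl⟩
  obtain ⟨l, hl, hp, hlen⟩ := Nat.find_spec hex
  refine ⟨l, hl, hp, ?_⟩
  rw [h.2]
  refine IsLeast.csInf_eq ⟨⟨l, hl, hp, rfl⟩, ?_⟩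
  rintro r ⟨l', hl', hp', rfl⟩
  rw [hlen]
  exact_mod_cast Nat.find_min' hex ⟨l', hl', hp', rfl⟩

theorem dist_le_length (h : IsWordMetric G S) (a b : G) (l : List G)
    (hl : ∀ x ∈ l, x ∈ S ∨ x⁻¹ ∈ S) (hp : l.prod = a⁻¹ * b) :
    dist a b ≤ (l.length : ℝ) := by
  rw [h.2]
  refine csInf_le ⟨0, ?_⟩ ⟨l, hl, hp, rfl⟩
  rintro r ⟨l', -, -, rfl⟩
  positivity

theorem dist_eq (h : IsWordMetric G S) (a b : G) : dist a b = dist 1 (a⁻¹ * b) := by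
  rw [h.2, h.2]; simp

theorem dist_one_inv (h : IsWordMetric G S) (a : G) : dist 1 a⁻¹ = dist 1 a := by
  rw [dist_comm 1 a, h.dist_eq a 1, mul_one]

theorem dist_one_mul_le (h : IsWordMetric G S) (a b : G) :
    dist 1 (a * b) ≤ dist 1 a + dist 1 b := by
  have h₁ := dist_triangle 1 a (a * b)
  rwa [h.dist_eq a (a * b), inv_mul_cancel_left] at h₁

theorem dist_one_le_one (h : IsWordMetric G S) {s : G} (hs : s ∈ S) : dist 1 s ≤ 1 := by
  simpa using h.dist_le_length 1 s [s] (by simp [hs]) (by simp)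

theorem finite_ball (h : IsWordMetric G S) (r : ℝ) : {a : G | dist 1 a ≤ r}.Finite := by
  classical
  have hA : {x : G | x ∈ S ∨ x⁻¹ ∈ S}.Finite := by
    refine (S.finite_toSet.union (S.finite_toSet.image (·⁻¹))).subset ?_
    rintro x (hx | hx)
    · exact Or.inl hx
    · exact Or.inr ⟨x⁻¹, hx, inv_inv x⟩
  have : Finite {x : G | x ∈ S ∨ x⁻¹ ∈ S} := hA
  refine ((List.finite_length_le {x : G | x ∈ S ∨ x⁻¹ ∈ S} ⌊r⌋₊).image
    fun l => (l.map Subtype.val).prod).subset ?_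
  intro a ha
  obtain ⟨l, hl, hp, hd⟩ := h.exists_list 1 a
  lift l to List {x : G | x ∈ S ∨ x⁻¹ ∈ S} using hl
  refine ⟨l, ?_, by simpa using hp⟩
  have : (l.length : ℝ) ≤ r := by simpa [hd] using ha
  exact Nat.le_floor this

theorem dist_smul_le {X : Type*} [PseudoMetricSpace X] [MulAction G X] (h : IsWordMetric G S)
    (hS : ∀ s ∈ S, ∀ x : X, dist x (s • x) ≤ 1) (a : G) (x : X) :
    dist x (a • x) ≤ dist 1 a := by
  obtain ⟨l, hl, hp, hd⟩ := h.exists_list 1 a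
  rw [hd]
  have ha : a = l.prod := by simpa using hp.symm
  subst ha
  clear hd hp
  induction l with
  | nil => simp
  | cons s l ih =>
    have h₁ := ih fun y hy => hl y (List.mem_cons_of_mem _ hy)
    have h₂ : dist (l.prod • x) (s • l.prod • x) ≤ 1 := by
      rcases hl s List.mem_cons_self with hs | hs
      · exact hS s hs _
      · simpa [dist_comm] using hS _ hs (s • l.prod • x)
    rw [List.prod_cons, mul_smul, List.length_cons]
    push_cast
    linarith [dist_triangle x (l.prod • x) (s • l.prod • x)]

end IsWordMetric

namespace lp

variable {p : ℝ≥0∞}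

theorem exists_interleave (hp₀ : 0 < p.toReal) (u v : lp (fun _ : ℕ => ℝ) p) :
    ∃ w : lp (fun _ : ℕ => ℝ) p,
      (∀ n, w n = Sum.elim u v (Equiv.natSumNatEquivNat.symm n)) ∧
      ‖w‖ ^ p.toReal = ‖u‖ ^ p.toReal + ‖v‖ ^ p.toReal := by
  have hs : HasSum (fun i : ℕ ⊕ ℕ => ‖Sum.elim u v i‖ ^ p.toReal)
      (‖u‖ ^ p.toReal + ‖v‖ ^ p.toReal) :=
    HasSum.sum (lp.hasSum_norm hp₀ u) (lp.hasSum_norm hp₀ v)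
  have hs' := (Equiv.natSumNatEquivNat.symm.hasSum_iff).2 hs
  let w : lp (fun _ : ℕ => ℝ) p :=
    ⟨fun n => Sum.elim u v (Equiv.natSumNatEquivNat.symm n), memℓp_gen hs'.summable⟩
  exact ⟨w, fun _ => rfl, (lp.hasSum_norm hp₀ w).unique hs'⟩

/-- The element of `ℓᵖ` whose coordinates are those of `u` and `v` put side by side. -/
noncomputable def interleave (hp₀ : 0 < p.toReal) (u v : lp (fun _ : ℕ => ℝ) p) :
    lp (fun _ : ℕ => ℝ) p := (exists_interleave hp₀ u v).choose

variable (hp₀ : 0 < p.toReal) (u v u' v' : lp (fun _ : ℕ => ℝ) p)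

theorem interleave_apply (n : ℕ) :
    interleave hp₀ u v n = Sum.elim u v (Equiv.natSumNatEquivNat.symm n) :=
  (exists_interleave hp₀ u v).choose_spec.1 n

theorem norm_interleave_rpow :
    ‖interleave hp₀ u v‖ ^ p.toReal = ‖u‖ ^ p.toReal + ‖v‖ ^ p.toReal :=
  (exists_interleave hp₀ u v).choose_spec.2

theorem interleave_sub :
    interleave hp₀ u v - interleave hp₀ u' v' = interleave hp₀ (u - u') (v - v') := by
  ext n
  rw [lp.coeFn_sub, Pi.sub_apply, interleave_apply, interleave_apply, interleave_apply]
  cases Equiv.natSumNatEquivNat.symm n <;> rfl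

theorem norm_left_le_interleave : ‖u‖ ≤ ‖interleave hp₀ u v‖ := by
  rw [← Real.rpow_le_rpow_iff (lp.norm_nonneg' u) (lp.norm_nonneg' _) hp₀, norm_interleave_rpow]
  linarith [Real.rpow_nonneg (lp.norm_nonneg' v) p.toReal]

theorem norm_right_le_interleave : ‖v‖ ≤ ‖interleave hp₀ u v‖ := by
  rw [← Real.rpow_le_rpow_iff (lp.norm_nonneg' v) (lp.norm_nonneg' _) hp₀, norm_interleave_rpow]
  linarith [Real.rpow_nonneg (lp.norm_nonneg' u) p.toReal]

theorem norm_interleave_le (hp₁ : 1 ≤ p.toReal) : ‖interleave hp₀ u v‖ ≤ ‖u‖ + ‖v‖ := by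
  have hu := lp.norm_nonneg' u
  have hv := lp.norm_nonneg' v
  rw [← Real.rpow_le_rpow_iff (lp.norm_nonneg' _) (add_nonneg hu hv) hp₀, norm_interleave_rpow]
  exact Real.add_rpow_le_rpow_add hu hv hp₁

end lp

theorem abs_sub_add_min_mul_triangle {t₁ t₂ t₃ d₁₂ d₂₃ d₁₃ : ℝ} (h₂ : 0 ≤ t₂)
    (h₁₂ : 0 ≤ d₁₂) (h₂₃ : 0 ≤ d₂₃) (h₁ : 0 ≤ t₁) (h₃ : 0 ≤ t₃)
    (htri : d₁₃ ≤ d₁₂ + d₂₃) (hle : d₁₃ ≤ 2) :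
    |t₁ - t₃| + min t₁ t₃ * d₁₃ ≤
      (|t₁ - t₂| + min t₁ t₂ * d₁₂) + (|t₂ - t₃| + min t₂ t₃ * d₂₃) := by
  have hm : 0 ≤ min t₁ t₃ := le_min h₁ h₃
  rcases le_or_gt (min t₁ t₃) t₂ with h | h
  · have e₁ : min t₁ t₃ * d₁₂ ≤ min t₁ t₂ * d₁₂ :=
      mul_le_mul_of_nonneg_right (le_min (min_le_left _ _) h) h₁₂
    have e₂ : min t₁ t₃ * d₂₃ ≤ min t₂ t₃ * d₂₃ :=
      mul_le_mul_of_nonneg_right (le_min h (min_le_right _ _)) h₂₃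
    have e₃ := mul_le_mul_of_nonneg_left htri hm
    linarith [abs_sub_le t₁ t₂ t₃]
  · obtain ⟨l₁, l₃⟩ := lt_min_iff.1 h
    rw [min_eq_right l₁.le, min_eq_left l₃.le, abs_of_pos (sub_pos.2 l₁), abs_sub_comm t₂,
      abs_of_pos (sub_pos.2 l₃)]
    have e₁ := mul_le_mul_of_nonneg_left htri h₂
    have e₂ := mul_le_mul_of_nonneg_left hle (sub_nonneg.2 h.le)
    have e₃ : |t₁ - t₃| = t₁ + t₃ - 2 * min t₁ t₃ := by
      rcases le_total t₁ t₃ with k | k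
      · rw [min_eq_left k, abs_of_nonpos (sub_nonpos.2 k)]; ring
      · rw [min_eq_right k, abs_of_nonneg (sub_nonneg.2 k)]; ring
    linarith

namespace WarpedCone

variable {Γ Y : Type*} [Group Γ] [MulAction Γ Y]

instance : MulAction Γ (WarpedCone Y) where
  smul := act
  one_smul x := Prod.ext (one_smul Γ x.1) rfl
  mul_smul γ η x := Prod.ext (mul_smul γ η x.1) rfl

theorem height_pos (x : WarpedCone Y) : 0 < x.height := x.2.2

/-- The cost of travelling from `x` to `y` by a single translation by `γ` followed by a move in
the cone over the pseudometric `D`. -/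
noncomputable def cost (len : Γ → ℝ) (D : Y → Y → ℝ) (x y : WarpedCone Y) (γ : Γ) : ℝ :=
  len γ + (|x.height - y.height| + min x.height y.height * D (γ • x.base) y.base)

/-- The warped distance determined by an invariant pseudometric. -/
noncomputable def orbitDist (len : Γ → ℝ) (D : Y → Y → ℝ) (x y : WarpedCone Y) : ℝ :=
  ⨅ γ, cost len D x y γ

/-- An invariant pseudometric on `Y` bounded by `2`, together with a length function on `Γ`. -/
structure IsWarpingData (len : Γ → ℝ) (D : Y → Y → ℝ) : Prop where
  len_one : len 1 = 0
  len_nonneg : ∀ γ, 0 ≤ len γ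
  len_inv : ∀ γ, len γ⁻¹ = len γ
  len_mul : ∀ γ η, len (γ * η) ≤ len γ + len η
  self : ∀ y, D y y = 0
  nonneg : ∀ y z, 0 ≤ D y z
  symm : ∀ y z, D y z = D z y
  triangle : ∀ x y z, D x z ≤ D x y + D y z
  le_two : ∀ y z, D y z ≤ 2
  smul : ∀ (γ : Γ) y z, D (γ • y) (γ • z) = D y z

namespace IsWarpingData

variable {len : Γ → ℝ} {D : Y → Y → ℝ} (h : IsWarpingData len D)
include h

theorem cost_nonneg (x y : WarpedCone Y) (γ : Γ) : 0 ≤ cost len D x y γ :=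
  add_nonneg (h.len_nonneg γ) (add_nonneg (abs_nonneg _)
    (mul_nonneg (le_min x.height_pos.le y.height_pos.le) (h.nonneg _ _)))

theorem orbitDist_le (x y : WarpedCone Y) (γ : Γ) : orbitDist len D x y ≤ cost len D x y γ :=
  ciInf_le ⟨0, by rintro _ ⟨γ, rfl⟩; exact h.cost_nonneg x y γ⟩ γ

theorem orbitDist_self (x : WarpedCone Y) : orbitDist len D x x = 0 :=
  le_antisymm ((h.orbitDist_le x x 1).trans_eq (by simp [cost, h.len_one, h.self]))
    (le_ciInf (h.cost_nonneg x x))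

theorem cost_inv (x y : WarpedCone Y) (γ : Γ) : cost len D y x γ⁻¹ = cost len D x y γ := by
  rw [cost, cost, h.len_inv, abs_sub_comm, min_comm, ← h.smul γ, smul_inv_smul, h.symm]

theorem orbitDist_comm (x y : WarpedCone Y) : orbitDist len D x y = orbitDist len D y x :=
  le_antisymm (le_ciInf fun γ => (h.orbitDist_le x y γ⁻¹).trans_eq (h.cost_inv y x γ))
    (le_ciInf fun γ => (h.orbitDist_le y x γ⁻¹).trans_eq (h.cost_inv x y γ))

theorem cost_mul_le (x y z : WarpedCone Y) (γ η : Γ) :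
    cost len D x z (η * γ) ≤ cost len D x y γ + cost len D y z η := by
  have h₁ := h.len_mul η γ
  have h₂ : D ((η * γ) • x.base) z.base ≤ D (γ • x.base) y.base + D (η • y.base) z.base := by
    rw [← h.smul η (γ • x.base), ← mul_smul]
    exact h.triangle _ _ _
  have h₃ := abs_sub_add_min_mul_triangle y.height_pos.le (h.nonneg (γ • x.base) y.base)
    (h.nonneg (η • y.base) z.base) x.height_pos.le z.height_pos.le h₂ (h.le_two _ _)
  unfold cost
  linarith

theorem orbitDist_triangle (x y z : WarpedCone Y) :
    orbitDist len D x z ≤ orbitDist len D x y + orbitDist len D y z :=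
  le_ciInf_add_ciInf fun γ η => (h.orbitDist_le x z (η * γ)).trans (h.cost_mul_le x y z γ η)

/-- On a set of small diameter and large height, translations by short group elements
between nearby points are unique and hence form a cocycle. -/
theorem exists_trivialization [PseudoMetricSpace (WarpedCone Y)]
    (hdist : ∀ x y : WarpedCone Y, orbitDist len D x y ≤ dist x y)
    {R T ε : ℝ} (hε : ∀ κ : Γ, len κ ≤ 3 * (R + 1) → κ ≠ 1 → ∀ y : Y, ε ≤ D (κ • y) y)
    (hT : 0 < T) (hT' : 3 * (R + 1) ≤ ε * T) (hTR : 2 * (R + 1) ≤ T) {C : Set (WarpedCone Y)}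
    (hCT : ∀ x ∈ C, T < x.height) (hCR : ∀ x ∈ C, ∀ y ∈ C, dist x y ≤ R) {x₀ : WarpedCone Y}
    (hx₀ : x₀ ∈ C) :
    ∃ γ : C → Γ, ∀ x y : C, x.1.height ≤ 2 * x₀.height ∧
      |x.1.height - y.1.height| ≤ dist x.1 y.1 + 1 ∧
      len (γ x * (γ y)⁻¹) ≤ dist x.1 y.1 + 1 ∧
      x₀.height * D ((γ x)⁻¹ • x.1.base) ((γ y)⁻¹ • y.1.base) ≤ 2 * (dist x.1 y.1 + 1) := by
  have hex : ∀ x y : WarpedCone Y, ∃ η, cost len D x y η < dist x y + 1 := fun x y =>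
    exists_lt_of_ciInf_lt ((hdist x y).trans_lt (lt_add_one _))
  have key : ∀ x y : WarpedCone Y, ∀ η, cost len D x y η < dist x y + 1 →
      len η ≤ dist x y + 1 ∧ |x.height - y.height| ≤ dist x y + 1 ∧
      min x.height y.height * D (η • x.base) y.base ≤ dist x y + 1 := by
    intro x y η hη
    have h₁ := h.len_nonneg η
    have h₂ := abs_nonneg (x.height - y.height)
    have h₃ := mul_nonneg (le_min x.height_pos.le y.height_pos.le)
      (h.nonneg (η • x.base) y.base)
    unfold cost at hη
    refine ⟨?_, ?_, ?_⟩ <;> linarith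
  have small : ∀ x ∈ C, ∀ y ∈ C, ∀ η, cost len D x y η < dist x y + 1 →
      D (η • x.base) y.base < ε / 3 := by
    intro x hx y hy η hη
    by_contra! hcon
    have h₁ := (key x y η hη).2.2
    have h₂ := hCR x hx y hy
    have hm : T < min x.height y.height := lt_min (hCT x hx) (hCT y hy)
    have hR : 0 < R + 1 := by linarith [dist_nonneg (x := x) (y := y)]
    have hε₀ : 0 < ε := by
      by_contra! hneg
      nlinarith
    nlinarith
  choose γ hγ using fun x : C => hex x₀ x
  refine ⟨γ, fun x y => ?_⟩
  obtain ⟨η, hη⟩ := hex x y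
  obtain ⟨a₁, a₂, a₃⟩ := key _ _ _ hη
  have dx := hCR _ hx₀ _ x.2
  have dy := hCR _ hx₀ _ y.2
  have dxy := hCR _ x.2 _ y.2
  obtain ⟨b₁, b₂, -⟩ := key _ _ _ (hγ x)
  obtain ⟨c₁, c₂, -⟩ := key _ _ _ (hγ y)
  have hcoc : γ y = η * γ x := by
    by_contra hne
    have hlen : len ((γ y)⁻¹ * (η * γ x)) ≤ 3 * (R + 1) := by
      have e₁ := h.len_mul (γ y)⁻¹ (η * γ x)
      have e₂ := h.len_mul η (γ x)
      rw [h.len_inv] at e₁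
      linarith
    have hsep := hε _ hlen (fun e => hne (inv_mul_eq_one.1 e)) x₀.base
    rw [← h.smul (γ y), smul_smul, mul_inv_cancel_left, mul_smul] at hsep
    have s₁ := small _ hx₀ _ x.2 _ (hγ x)
    have s₂ := small _ hx₀ _ y.2 _ (hγ y)
    have s₃ := small _ x.2 _ y.2 _ hη
    rw [← h.smul η] at s₁
    rw [h.symm] at s₂
    linarith [h.triangle (η • γ x • x₀.base) (η • x.1.base) (γ y • x₀.base),
      h.triangle (η • x.1.base) y.1.base (γ y • x₀.base)]
  have t₀ := hCT _ hx₀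
  refine ⟨by linarith [(abs_le.1 b₂).1], a₂, ?_, ?_⟩
  · rwa [hcoc, mul_inv_rev, mul_inv_cancel_left, h.len_inv]
  · have hD : D ((γ x)⁻¹ • x.1.base) ((γ y)⁻¹ • y.1.base) = D (η • x.1.base) y.1.base := by
      rw [← h.smul (γ y), smul_inv_smul, hcoc, mul_smul, smul_inv_smul]
    rw [hD]
    have hm : x₀.height ≤ 2 * min x.1.height y.1.height := by
      have : x₀.height / 2 ≤ min x.1.height y.1.height :=
        le_min (by linarith [(abs_le.1 b₂).2]) (by linarith [(abs_le.1 c₂).2])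
      linarith
    have := mul_le_mul_of_nonneg_right hm (h.nonneg (η • x.1.base) y.1.base)
    linarith

end IsWarpingData

end WarpedCone

/-- Proposition 2.11: if a free action `Γ ↷ Y` of a finitely generated group on a compact
metric space by homeomorphisms is linearizable in `ℓᵖ` (`1 ≤ p < ∞`) and `Γ` coarsely embeds
into `ℓᵖ`, then the warped cone `O_Γ Y` admits a coarse embedding at infinity into `ℓᵖ`. -/
theorem warped_cone_coarse_emb_at_infinity
    (p : ℝ≥0∞) [Fact (1 ≤ p)] (hp : p ≠ ∞)
    (Y : Type) [MetricSpace Y] [CompactSpace Y]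
    (Γ : Type) [Group Γ] [MulAction Γ Y]
    -- Γ acts by homeomorphisms and freely
    (hcont : ∀ γ : Γ, Continuous fun y : Y => γ • y)
    (hfree : ∀ (γ : Γ) (y : Y), γ • y = y → γ = 1)
    -- the word metric of a finite generating set S on Γ
    (S : Finset Γ) [MetricSpace Γ] (hword : IsWordMetric Γ S)
    -- the action is linearizable in ℓᵖ: an isometric linear representation π together
    -- with a Γ-equivariant bi-Lipschitz embedding φ : Y → ℓᵖ
    (π : Γ → (lp (fun _ : ℕ => ℝ) p ≃ₗᵢ[ℝ] lp (fun _ : ℕ => ℝ) p))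
    (hπ : ∀ γ η : Γ, ∀ v, π (γ * η) v = π γ (π η v))
    (φ : Y → lp (fun _ : ℕ => ℝ) p) (L : ℝ) (hL : 0 < L)
    (hbilip : ∀ y₁ y₂ : Y,
      L⁻¹ * dist y₁ y₂ ≤ ‖φ y₁ - φ y₂‖ ∧ ‖φ y₁ - φ y₂‖ ≤ L * dist y₁ y₂)
    (hequiv : ∀ (γ : Γ) (y : Y), φ (γ • y) = π γ (φ y))
    -- a coarse embedding of Γ into ℓᵖ
    (g : Γ → lp (fun _ : ℕ => ℝ) p) (ρm ρp : ℝ → ℝ)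
    (hρm : Monotone ρm) (hρp : Monotone ρp) (hρm_top : Tendsto ρm atTop atTop)
    (hg : ∀ γ η : Γ, ρm (dist γ η) ≤ ‖g γ - g η‖ ∧ ‖g γ - g η‖ ≤ ρp (dist γ η))
    -- the warped metric: the greatest metric below the cone metric with d(x, sx) ≤ 1
    [MetricSpace (WarpedCone Y)]
    (hw₁ : ∀ x y : WarpedCone Y, dist x y ≤ coneDist x y)
    (hw₂ : ∀ (x : WarpedCone Y), ∀ s ∈ S, dist x (WarpedCone.act s x) ≤ 1)
    (hw₃ : ∀ d' : WarpedCone Y → WarpedCone Y → ℝ,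
      (∀ x, d' x x = 0) → (∀ x y, d' x y = d' y x) →
      (∀ x y z, d' x z ≤ d' x y + d' y z) →
      (∀ x y, d' x y ≤ coneDist x y) →
      (∀ (x : WarpedCone Y), ∀ s ∈ S, d' x (WarpedCone.act s x) ≤ 1) →
      ∀ x y, d' x y ≤ dist x y) :
    CoarseEmbAtInfinityInto (WarpedCone Y) (lp (fun _ : ℕ => ℝ) p) := by
  have hq : 1 ≤ p.toReal := by
    simpa using ENNReal.toReal_mono hp (Fact.out : 1 ≤ p)
  have hq₀ : 0 < p.toReal := one_pos.trans_le hq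
  set Δ : ℝ := diam (Set.univ : Set Y)
  have hΔ₀ : 0 ≤ Δ := diam_nonneg
  have hdΔ : ∀ y z : Y, dist y z ≤ Δ := fun y z =>
    dist_le_diam_of_mem isCompact_univ.isBounded trivial trivial
  have hinv : ∀ (γ : Γ) y z, ‖φ (γ • y) - φ (γ • z)‖ = ‖φ y - φ z‖ := fun γ y z => by
    rw [hequiv, hequiv, ← map_sub, LinearIsometryEquiv.norm_map]
  set D : Y → Y → ℝ := fun y z => ‖φ y - φ z‖ / (L * Δ) with hD
  have hDle : ∀ y z, D y z ≤ dist y z / Δ := fun y z => by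
    rw [← mul_div_mul_left _ Δ hL.ne']
    exact div_le_div_of_nonneg_right (hbilip y z).2 (by positivity)
  have hledD : ∀ y z, dist y z / Δ ≤ L ^ 2 * D y z := fun y z => by
    have h₁ : dist y z ≤ L * ‖φ y - φ z‖ := (inv_mul_le_iff₀ hL).1 (hbilip y z).1
    have h₂ : L ^ 2 * D y z = L * ‖φ y - φ z‖ / Δ := by
      rw [← mul_div_mul_left (L * ‖φ y - φ z‖) Δ hL.ne', hD]
      ring
    rw [h₂]
    exact div_le_div_of_nonneg_right h₁ hΔ₀
  have hdata : WarpedCone.IsWarpingData (fun γ : Γ => dist 1 γ) D :=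
    { len_one := dist_self _
      len_nonneg := fun _ => dist_nonneg
      len_inv := hword.dist_one_inv
      len_mul := hword.dist_one_mul_le
      self := fun y => by simp [hD]
      nonneg := fun y z => by positivity
      symm := fun y z => by simp only [hD, norm_sub_rev]
      triangle := fun x y z => by
        simp only [hD, ← add_div]
        exact div_le_div_of_nonneg_right (norm_sub_le_norm_sub_add_norm_sub _ _ _) (by positivity)
      le_two := fun y z => by
        have := (hDle y z).trans (div_le_one_of_le₀ (hdΔ y z) hΔ₀)
        linarith
      smul := fun γ y z => by simp only [hD, hinv] }
  have hdist : ∀ x y : WarpedCone Y,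
      WarpedCone.orbitDist (fun γ : Γ => dist 1 γ) D x y ≤ dist x y := by
    refine hw₃ _ hdata.orbitDist_self hdata.orbitDist_comm hdata.orbitDist_triangle ?_ ?_
    · intro x y
      refine (hdata.orbitDist_le x y 1).trans ?_
      simp only [WarpedCone.cost, dist_self, zero_add, one_smul, coneDist, mul_div_assoc]
      have := mul_le_mul_of_nonneg_left (hDle x.base y.base)
        (le_min x.height_pos.le y.height_pos.le)
      gcongr
    · intro x s hs
      refine (hdata.orbitDist_le x _ s).trans ?_
      have h₁ : (WarpedCone.act s x).height = x.height := rfl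
      have h₂ : (WarpedCone.act s x).base = s • x.base := rfl
      simpa [WarpedCone.cost, h₁, h₂, hdata.self] using hword.dist_one_le_one hs
  have hsmul : ∀ (γ : Γ) (x : WarpedCone Y), dist x (γ • x) ≤ dist 1 γ :=
    hword.dist_smul_le fun s hs x => hw₂ x s hs
  have hφ : Continuous φ := by
    refine (LipschitzWith.of_dist_le_mul (K := ⟨L, hL.le⟩) fun y z => ?_).continuous
    rw [dist_eq_norm]
    exact (hbilip y z).2
  have hsep : ∀ r : ℝ, ∃ ε > 0, ∀ κ : Γ, dist 1 κ ≤ r → κ ≠ 1 → ∀ y : Y, ε ≤ D (κ • y) y := by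
    intro r
    have hone : ∀ κ : Γ, ∃ ε > 0, κ ≠ 1 → ∀ y : Y, ε ≤ D (κ • y) y := by
      intro κ
      by_cases hκ : κ = 1
      · exact ⟨1, one_pos, fun h => (h hκ).elim⟩
      have hc : Continuous fun y => D (κ • y) y :=
        ((hφ.comp (hcont κ)).sub hφ).norm.div_const _
      obtain ⟨ε, hε, hle⟩ := isCompact_univ.exists_forall_le' hc.continuousOn (a := 0)
        fun y _ => by
          have hy : 0 < dist (κ • y) y := dist_pos.2 fun h => hκ (hfree κ y h)
          have hy' := hy.trans_le (hdΔ (κ • y) y)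
          exact (mul_pos_iff_of_pos_left (by positivity)).1
            ((div_pos hy hy').trans_le (hledD (κ • y) y))
      exact ⟨ε, hε, fun _ y => hle y trivial⟩
    choose ε hε hεle using hone
    obtain ⟨δ, -, hδ⟩ := Set.exists_min_image _ ε ((hword.finite_ball r).insert 1)
      (Set.insert_nonempty _ _)
    exact ⟨ε δ, hε δ, fun κ hκ hne y =>
      (hδ κ (Set.mem_insert_of_mem _ hκ)).trans (hεle κ hne y)⟩
  have hupper : ∀ (κ : Γ) (x y : WarpedCone Y), dist x y ≤ dist 1 κ +
      (|x.height - y.height| + min x.height y.height * (L ^ 2 * D (κ • x.base) y.base)) := by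
    intro κ x y
    have h₁ : dist (κ • x) y ≤ |x.height - y.height| +
        min x.height y.height * dist (κ • x.base) y.base / Δ := hw₁ (κ • x) y
    have h₂ := mul_le_mul_of_nonneg_left (hledD (κ • x.base) y.base)
      (le_min x.height_pos.le y.height_pos.le)
    rw [mul_div_assoc] at h₁
    linarith [dist_triangle x (κ • x) y, hsmul κ x]
  refine ⟨fun d => min (ρm (d / 2)) (d / (2 * (1 + 2 * L ^ 2))),
    fun d => 3 * (d + 1) + max (ρp (d + 1)) 0, ?_, ?_, ?_, ?_, ?_⟩
  · exact fun a b hab => min_le_min (hρm (by linarith)) (by gcongr)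
  · exact fun a b hab => add_le_add (by linarith) (max_le_max (hρp (by linarith)) le_rfl)
  · have t₁ : Tendsto (fun d => ρm (d / 2)) atTop atTop :=
      hρm_top.comp (tendsto_id.atTop_div_const two_pos)
    have t₂ : Tendsto (fun d : ℝ => d / (2 * (1 + 2 * L ^ 2))) atTop atTop :=
      tendsto_id.atTop_div_const (by positivity)
    refine tendsto_atTop.2 fun M => ?_
    filter_upwards [tendsto_atTop.1 t₁ M, tendsto_atTop.1 t₂ M] with d h₁ h₂
    exact le_min h₁ h₂
  · refine tendsto_atTop_mono (fun d => ?_) ((tendsto_atTop_add_const_right _ (1 : ℝ)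
      tendsto_id).const_mul_atTop (three_pos : (0 : ℝ) < 3))
    exact le_add_of_nonneg_right (le_max_right _ _)
  intro R hR
  obtain ⟨ε, hε, hεle⟩ := hsep (3 * (R + 1))
  set T := max (2 * (R + 1)) (3 * (R + 1) / ε)
  have hT₀ : 0 < T := lt_max_of_lt_left (by linarith)
  have hTε : 3 * (R + 1) ≤ ε * T := (div_le_iff₀' hε).1 (le_max_right _ _)
  refine ⟨{x | x.height ≤ T}, ?_, ?_⟩
  · refine isBounded_iff.2 ⟨T + T * 1, fun x hx y hy => (hw₁ x y).trans ?_⟩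
    have hx' := x.height_pos
    have hy' := y.height_pos
    rw [Set.mem_ofPred_eq] at hx hy
    rw [coneDist, mul_div_assoc]
    exact add_le_add (abs_le.2 ⟨by linarith, by linarith⟩)
      (mul_le_mul ((min_le_left _ _).trans hx) (div_le_one_of_le₀ (hdΔ _ _) hΔ₀)
        (by positivity) hT₀.le)
  intro C hC hCK hCR
  rcases C.eq_empty_or_nonempty with rfl | ⟨x₀, hx₀⟩
  · exact ⟨fun _ => 0, fun x => x.2.elim⟩
  obtain ⟨γ, hγ⟩ := hdata.exists_trivialization hdist hεle hT₀ hTε (le_max_left _ _)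
    (fun x hx => not_le.1 (hCK hx))
    (fun x hx y hy => (dist_le_diam_of_mem hC hx hy).trans hCR) hx₀
  have ht₀ := x₀.height_pos
  let e : lp (fun _ : ℕ => ℝ) p := lp.single p 0 (1 : ℝ)
  have he : ‖e‖ = 1 := by simp [e, lp.norm_single (zero_lt_one.trans_le Fact.out)]
  refine ⟨fun x => lp.interleave hq₀ (lp.interleave hq₀ (g (γ x)⁻¹)
    ((x₀.height / (L * Δ)) • φ ((γ x)⁻¹ • x.1.base))) (x.1.height • e), fun x y => ?_⟩
  obtain ⟨h₁, h₂, h₃, h₄⟩ := hγ x y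
  set a := γ x
  set b := γ y
  have hg' := hg a⁻¹ b⁻¹
  rw [hword.dist_eq, inv_inv] at hg'
  have n₂ : ‖(x₀.height / (L * Δ)) • φ (a⁻¹ • x.1.base) -
      (x₀.height / (L * Δ)) • φ (b⁻¹ • y.1.base)‖ =
      x₀.height * D (a⁻¹ • x.1.base) (b⁻¹ • y.1.base) := by
    rw [← smul_sub, norm_smul, Real.norm_of_nonneg (by positivity), hD]
    ring
  have n₃ : ‖x.1.height • e - y.1.height • e‖ = |x.1.height - y.1.height| := by
    rw [← sub_smul, norm_smul, he, mul_one, Real.norm_eq_abs]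
  rw [lp.interleave_sub, lp.interleave_sub]
  set u := g a⁻¹ - g b⁻¹
  set v := (x₀.height / (L * Δ)) • φ (a⁻¹ • x.1.base) -
      (x₀.height / (L * Δ)) • φ (b⁻¹ • y.1.base)
  set w := x.1.height • e - y.1.height • e
  constructor
  · set N := ‖lp.interleave hq₀ (lp.interleave hq₀ u v) w‖
    have l₀ : ‖lp.interleave hq₀ u v‖ ≤ N := lp.norm_left_le_interleave _ _ _
    have l₁ : ‖u‖ ≤ N := (lp.norm_left_le_interleave _ _ _).trans l₀
    have l₂ : ‖v‖ ≤ N := (lp.norm_right_le_interleave _ _ _).trans l₀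
    have l₃ : ‖w‖ ≤ N := lp.norm_right_le_interleave _ _ _
    have hu := hupper (b * a⁻¹) x.1 y.1
    have e₁ : dist 1 (b * a⁻¹) = dist 1 (a * b⁻¹) := by
      rw [← hword.dist_one_inv, mul_inv_rev, inv_inv]
    have e₂ : D ((b * a⁻¹) • x.1.base) y.1.base = D (a⁻¹ • x.1.base) (b⁻¹ • y.1.base) := by
      rw [← hdata.smul b (a⁻¹ • x.1.base), smul_inv_smul, mul_smul]
    rw [e₁, e₂] at hu
    have hDn := hdata.nonneg (a⁻¹ • x.1.base) (b⁻¹ • y.1.base)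
    have hm : min x.1.height y.1.height * (L ^ 2 * D (a⁻¹ • x.1.base) (b⁻¹ • y.1.base)) ≤
        2 * L ^ 2 * N := by
      calc _ ≤ 2 * x₀.height * (L ^ 2 * D (a⁻¹ • x.1.base) (b⁻¹ • y.1.base)) :=
            mul_le_mul_of_nonneg_right ((min_le_left _ _).trans h₁) (by positivity)
        _ = 2 * L ^ 2 * ‖v‖ := by rw [n₂]; ring
        _ ≤ _ := by gcongr
    rcases le_total (dist x.1 y.1 / 2) (dist 1 (a * b⁻¹)) with h | h
    · exact (min_le_left _ _).trans ((hρm h).trans (hg'.1.trans l₁))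
    · refine (min_le_right _ _).trans ((div_le_iff₀ (by positivity)).2 ?_)
      linarith
  · have r₁ := lp.norm_interleave_le hq₀ (lp.interleave hq₀ u v) w hq
    have r₂ := lp.norm_interleave_le hq₀ u v hq
    have r₃ : ‖u‖ ≤ max (ρp (dist x.1 y.1 + 1)) 0 :=
      (hg'.2.trans (hρp h₃)).trans (le_max_left _ _)
    linarith
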